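/- Let 0 < p < 1, q = 1 − p, and for x₁, x₂ ∈ [0,1] define f₁(x₁,x₂) = (p/2 + q(1−x₁))/(1 − q²x₁x₂). If 0 ≤ x₂ < x₁ ≤ 1 and f₁(x₁,x₂) ≥ 1/2, then f₁(x₁,x₁) ≥ 1/2. -/

import Mathlib

theorem stmt_10 (p q : ℝ) (hp0 : 0 < p) (hp1 : p < 1) (hq : q = 1 - p)
    (x₁ x₂ : ℝ) (hx₂0 : 0 ≤ x₂) (hlt : x₂ < x₁) (hx₁1 : x₁ ≤ 1)
    (h : (p / 2 + q * (1 - x₁)) / (1 - q ^ 2 * x₁ * x₂) ≥ 1 / 2) :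
    (p / 2 + q * (1 - x₁)) / (1 - q ^ 2 * x₁ * x₁) ≥ 1 / 2 := by
  have hq0 : 0 < q := by linarith
  have hq1 : q < 1 := by linarith
  have hx : 0 < x₁ := by linarith
  have hN : 0 ≤ p / 2 + q * (1 - x₁) := by
    have := mul_nonneg hq0.le (sub_nonneg.2 hx₁1)
    linarith
  have h1 : q * x₁ < 1 := by nlinarith
  have h0 : 0 < q * x₁ := mul_pos hq0 hx
  have hD : 0 < 1 - q ^ 2 * x₁ * x₁ := by nlinarith
  have hle : 1 - q ^ 2 * x₁ * x₁ ≤ 1 - q ^ 2 * x₁ * x₂ := by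
    have := mul_le_mul_of_nonneg_left hlt.le (by positivity : 0 ≤ q ^ 2 * x₁)
    linarith
  exact le_trans h (div_le_div_of_nonneg_left hN hD hle)
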